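/- arXiv:0905.1351 — 2 statements merged into one kernel-verified Lean document; each statement's English description precedes it below -/
import Mathlib

section
/- For distinct nonnegative integers n₁ ≠ n₂, the entire functions F₁(z) = ∫₀¹ e^{izt} t^{n₁} dt and F₂(z) = ∫₀¹ e^{izt} t^{n₂} dt have no common zeroes. -/
open MeasureTheory Complex intervalIntegral

open Polynomial
open scoped Nat

theorem exists_intPolynomial_eval_zero_ne_zero {K : Type*} [Field K] [CharZero K]
    [Algebra.IsAlgebraic ℚ K] (s : Finset K) (hs : (0 : K) ∉ s) :
    ∃ f : ℤ[X], f.eval 0 ≠ 0 ∧ ∀ u ∈ s, aeval u f = 0 := by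
  have h : ∀ u : K, u ≠ 0 → ∃ f : ℤ[X], f.coeff 0 ≠ 0 ∧ aeval u f = 0 := fun u hu ↦
    ((IsFractionRing.isAlgebraic_iff ℤ ℚ K).mpr
      (Algebra.IsAlgebraic.isAlgebraic u)).exists_nonzero_coeff_and_aeval_eq_zero
        (mem_nonZeroDivisors_of_ne_zero hu)
  choose! f hf0 hf using h
  have hne : ∀ u ∈ s, u ≠ 0 := fun u hu ↦ ne_of_mem_of_not_mem hu hs
  refine ⟨∏ u ∈ s, f u, ?_, fun u hu ↦ ?_⟩
  · rw [eval_prod]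
    refine Finset.prod_ne_zero_iff.mpr fun u hu ↦ ?_
    rw [← coeff_zero_eq_eval_zero]
    exact hf0 u (hne u hu)
  · rw [map_prod]
    exact Finset.prod_eq_zero hu (hf u (hne u hu))

theorem isIntegral_pow_mul_aeval {K : Type*} [CommRing K] {d : ℤ} {u : K}
    (hu : IsIntegral ℤ (d * u)) (g : ℤ[X]) {k : ℕ} (hk : g.natDegree ≤ k) :
    IsIntegral ℤ ((d : K) ^ k * aeval u g) := by
  rw [aeval_eq_sum_range, Finset.mul_sum]
  refine IsIntegral.sum _ fun i hi ↦ ?_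
  have hik : i ≤ k := (Nat.lt_succ_iff.mp (Finset.mem_range.mp hi)).trans hk
  have : (d : K) ^ k * g.coeff i • u ^ i =
      ((d ^ (k - i) * g.coeff i : ℤ) : K) * (d * u) ^ i := by
    rw [← Nat.sub_add_cancel hik, pow_add, Nat.sub_add_cancel hik, zsmul_eq_mul]
    push_cast
    ring
  rw [this]
  exact (isIntegral_algebraMap (R := ℤ) (A := K) (x := d ^ (k - i) * g.coeff i)).mul (hu.pow i)

theorem exists_int_eq_of_isIntegral_of_fixed {K : Type*} [Field K] [NumberField K] [IsGalois ℚ K]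
    {x : K} (hx : IsIntegral ℤ x) (hfix : ∀ σ : K ≃ₐ[ℚ] K, σ x = x) : ∃ z : ℤ, x = z := by
  obtain ⟨q, rfl⟩ := IntermediateField.mem_bot.mp ((IsGalois.mem_bot_iff_fixed x).mpr hfix)
  rw [isIntegral_algebraMap_iff (algebraMap ℚ K).injective] at hx
  obtain ⟨z, rfl⟩ := IsIntegrallyClosed.isIntegral_iff.mp hx
  exact ⟨z, by simp⟩

theorem exists_forall_mul_pow_div_factorial_lt_one (A B : ℝ) :
    ∃ n₀ : ℕ, ∀ p ≥ n₀, B * A ^ p / (p - 1)! < 1 := by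
  have h : Filter.Tendsto (fun n : ℕ ↦ B * A * (A ^ n / n !)) Filter.atTop (nhds 0) := by
    simpa using (FloorSemiring.tendsto_pow_div_factorial_atTop A).const_mul (B * A)
  obtain ⟨n₀, hn₀⟩ := Filter.eventually_atTop.mp (h.eventually_lt_const one_pos)
  refine ⟨n₀ + 1, fun p hp ↦ ?_⟩
  obtain ⟨q, rfl⟩ := Nat.exists_eq_add_of_le' (Nat.one_le_of_lt hp)
  have := hn₀ q (by omega)
  rw [Nat.add_sub_cancel, pow_succ]
  convert! this using 1
  ring

/-- A Galois-equivariant exponential sum with algebraic data and nonzero integer constant term does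
not vanish. -/
theorem sum_exp_ne_zero_of_galois_equivariant {K : Type*} [Field K] [NumberField K]
    [IsGalois ℚ K] [Algebra K ℂ] (c : K →₀ K)
    (hc : ∀ (σ : K ≃ₐ[ℚ] K) (u : K), c (σ u) = σ (c u)) {n : ℤ} (hn : n ≠ 0) (h0 : c 0 = n) :
    (c.sum fun u a ↦ algebraMap K ℂ a * exp (algebraMap K ℂ u)) ≠ 0 := by
  classical
  intro hsum
  set S := c.support.erase 0 with hS
  have h0mem : (0 : K) ∈ c.support := by simp [h0, hn]
  have hsum' : (n : ℂ) + ∑ u ∈ S, algebraMap K ℂ (c u) * exp (algebraMap K ℂ u) = 0 := by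
    rw [Finsupp.sum, ← Finset.add_sum_erase _ _ h0mem] at hsum
    simpa [h0] using hsum
  obtain ⟨f, hf0, hf⟩ := exists_intPolynomial_eval_zero_ne_zero S (Finset.notMem_erase _ _)
  have hroot : ∀ u ∈ S, algebraMap K ℂ u ∈ f.aroots ℂ := fun u hu ↦ by
    rw [mem_aroots, aeval_algebraMap_apply, hf u hu, map_zero]
    exact ⟨by rintro rfl; simp at hf0, rfl⟩
  obtain ⟨M, hM⟩ := LindemannWeierstrass.exp_polynomial_approx f hf0
  have : Algebra.IsAlgebraic ℤ K := ⟨fun x ↦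
    (IsFractionRing.isAlgebraic_iff ℤ ℚ K).mpr (Algebra.IsAlgebraic.isAlgebraic x)⟩
  obtain ⟨d, hd, hint⟩ :=
    Algebra.IsAlgebraic.exists_integral_multiples ℤ (S ∪ S.image c)
  simp only [zsmul_eq_mul] at hint
  set D := f.natDegree
  set C := ∑ u ∈ S, ‖algebraMap K ℂ (c u)‖ with hC
  obtain ⟨n₀, hn₀⟩ :=
    exists_forall_mul_pow_div_factorial_lt_one (|(d : ℝ)| ^ D * M) (|(d : ℝ)| * C)
  obtain ⟨p, hp, hprime⟩ :=
    Nat.exists_infinite_primes (n₀ + (eval 0 f).natAbs + d.natAbs + n.natAbs + 1)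
  obtain ⟨N, hN, g, hg, happrox⟩ := hM p (by omega) hprime
  set T := ∑ u ∈ S, c u * aeval u g with hT
  have hTfix : ∀ σ : K ≃ₐ[ℚ] K, σ T = T := fun σ ↦ by
    rw [hT, map_sum]
    refine Finset.sum_equiv σ.toEquiv (fun u ↦ ?_) fun u _ ↦ ?_
    · simp [hS, hc]
    · have : σ (aeval u g) = aeval (σ u) g :=
        (aeval_algHom_apply (σ : K →+* K).toIntAlgHom u g).symm
      simp [hc, this]
  obtain ⟨z, hz⟩ : ∃ z : ℤ, (d : K) ^ (p * D + 1) * T = z := by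
    refine exists_int_eq_of_isIntegral_of_fixed ?_ fun σ ↦ by simp [hTfix]
    rw [hT, Finset.mul_sum]
    refine IsIntegral.sum _ fun u hu ↦ ?_
    have := (hint (c u) (by simp; grind)).mul
      (isIntegral_pow_mul_aeval (hint u (by simp [hu])) g (hg.trans (Nat.sub_le _ _)))
    convert this using 1
    ring
  have hbound : ‖(N * n : ℂ) + p * algebraMap K ℂ T‖ ≤ C * (M ^ p / (p - 1)!) := by
    have : (N * n : ℂ) + p * algebraMap K ℂ T = -∑ u ∈ S, algebraMap K ℂ (c u) *
        (N • exp (algebraMap K ℂ u) - p • aeval (algebraMap K ℂ u) g) := by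
      rw [eq_neg_of_add_eq_zero_left hsum', hT, map_sum, mul_neg, Finset.mul_sum, Finset.mul_sum,
        ← Finset.sum_neg_distrib, ← Finset.sum_neg_distrib, ← Finset.sum_add_distrib]
      refine Finset.sum_congr rfl fun u _ ↦ ?_
      rw [map_mul, ← aeval_algebraMap_apply, zsmul_eq_mul, nsmul_eq_mul]
      ring
    rw [this, norm_neg, hC, Finset.sum_mul]
    refine (norm_sum_le _ _).trans (Finset.sum_le_sum fun u hu ↦ ?_)
    rw [norm_mul]
    gcongr
    exact happrox (hroot u hu)
  have hzero : d ^ (p * D + 1) * (N * n) + p * z = 0 := by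
    rw [← Int.abs_lt_one_iff, ← Int.cast_lt (R := ℝ), Int.cast_abs, ← Complex.norm_intCast]
    have hcast : ((d ^ (p * D + 1) * (N * n) + p * z : ℤ) : ℂ) =
        (d : ℂ) ^ (p * D + 1) * ((N * n : ℂ) + p * algebraMap K ℂ T) := by
      have := congrArg (algebraMap K ℂ) hz
      simp only [map_mul, map_pow, map_intCast] at this
      push_cast
      rw [← this]
      ring
    rw [hcast, norm_mul, norm_pow, Complex.norm_intCast, Int.cast_one]
    refine lt_of_le_of_lt ?_ (hn₀ p (by omega))
    calc _ ≤ |(d : ℝ)| ^ (p * D + 1) * (C * (M ^ p / (p - 1)!)) := by gcongr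
      _ = _ := by rw [mul_pow, ← pow_mul]; ring
  have hdvd : (p : ℤ) ∣ d ^ (p * D + 1) * (N * n) :=
    ⟨-z, by linear_combination hzero⟩
  have hp' : Prime (p : ℤ) := Nat.prime_iff_prime_int.mp hprime
  have hsmall : ∀ {a : ℤ}, a ≠ 0 → a.natAbs < p → ¬ (p : ℤ) ∣ a := fun ha hlt h ↦
    (Nat.le_of_dvd (Int.natAbs_pos.mpr ha) (Int.natCast_dvd.mp h)).not_gt hlt
  rcases hp'.dvd_or_dvd hdvd with h | h
  · exact hsmall hd (by omega) (hp'.dvd_of_dvd_pow h)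
  · rcases hp'.dvd_or_dvd h with h | h
    · exact hN h
    · exact hsmall hn (by omega) h

/-- The action of a field automorphism on both coefficients and exponents of a formal exponential
sum. -/
noncomputable def galoisMap {K : Type*} [Field K] [Algebra ℚ K] (σ : K ≃ₐ[ℚ] K) :
    AddMonoidAlgebra K K →+* AddMonoidAlgebra K K :=
  (AddMonoidAlgebra.mapRingHom K (σ : K →+* K)).comp
    (AddMonoidAlgebra.mapDomainRingHom K (σ : K →+ K))

section galoisMap

variable {K : Type*} [Field K] [Algebra ℚ K]

theorem coeff_galoisMap (σ : K ≃ₐ[ℚ] K) (x : AddMonoidAlgebra K K) (u : K) :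
    (galoisMap σ x).coeff (σ u) = σ (x.coeff u) := by
  have : (Finsupp.mapDomain σ x.coeff) (σ u) = x.coeff u :=
    Finsupp.mapDomain_apply σ.injective _ _
  simp [galoisMap, this]

theorem galoisMap_mul (σ τ : K ≃ₐ[ℚ] K) (x : AddMonoidAlgebra K K) :
    galoisMap (σ * τ) x = galoisMap σ (galoisMap τ x) := by
  ext u
  obtain ⟨v, rfl⟩ := (σ * τ).surjective u
  rw [coeff_galoisMap, AlgEquiv.mul_apply, AlgEquiv.mul_apply, coeff_galoisMap, coeff_galoisMap]

theorem galoisMap_injective (σ : K ≃ₐ[ℚ] K) : Function.Injective (galoisMap σ) := by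
  refine (injective_iff_map_eq_zero _).mpr fun x hx ↦ ?_
  ext u
  have := coeff_galoisMap σ x u
  rw [hx] at this
  simpa using this.symm

end galoisMap

/-- Evaluation of a formal exponential sum `∑ a [u]` as `∑ a * exp u`. -/
noncomputable def evalExp (K : Type*) [Field K] [Algebra K ℂ] : AddMonoidAlgebra K K →+* ℂ :=
  AddMonoidAlgebra.liftNCRingHom (algebraMap K ℂ)
    (expMonoidHom.comp (AddMonoidHom.toMultiplicative (algebraMap K ℂ : K →+ ℂ)))
    fun _ _ ↦ Commute.all _ _

theorem evalExp_single {K : Type*} [Field K] [Algebra K ℂ] (u a : K) :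
    evalExp K (.single u a) = algebraMap K ℂ a * exp (algebraMap K ℂ u) := by
  simp [evalExp]

theorem evalExp_apply {K : Type*} [Field K] [Algebra K ℂ] (x : AddMonoidAlgebra K K) :
    evalExp K x = x.coeff.sum fun u a ↦ algebraMap K ℂ a * exp (algebraMap K ℂ u) := by
  conv_lhs => rw [← AddMonoidAlgebra.sum_coeff_single x]
  rw [map_finsuppSum]
  simp only [evalExp_single]

/-- The **Lindemann–Weierstrass theorem** over a Galois number field. -/
theorem evalExp_ne_zero {K : Type*} [Field K] [NumberField K] [IsGalois ℚ K] [Algebra K ℂ]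
    {x : AddMonoidAlgebra K K} (hx : x ≠ 0) : evalExp K x ≠ 0 := by
  classical
  intro h
  set F := ∏ σ : K ≃ₐ[ℚ] K, galoisMap σ x with hF
  have hF0 : F ≠ 0 := Finset.prod_ne_zero_iff.mpr fun σ _ ↦
    (map_ne_zero_iff _ (galoisMap_injective σ)).mpr hx
  have hFfix : ∀ τ : K ≃ₐ[ℚ] K, galoisMap τ F = F := fun τ ↦ by
    rw [hF, map_prod]
    exact Fintype.prod_equiv (Equiv.mulLeft τ) _ _ fun σ ↦ (galoisMap_mul τ σ x).symm
  have hFeval : evalExp K F = 0 := by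
    rw [hF, map_prod]
    refine Finset.prod_eq_zero (Finset.mem_univ 1) ?_
    rw [← h]
    congr 1
    ext u
    exact coeff_galoisMap 1 x u
  obtain ⟨u, hu⟩ : ∃ u, F.coeff u ≠ 0 := by
    by_contra! hcon
    exact hF0 (by ext u; simpa using hcon u)
  set y : AddMonoidAlgebra K K := .single (-u) (F.coeff u)⁻¹ with hy
  set H := ∑ σ : K ≃ₐ[ℚ] K, galoisMap σ (F * y) with hH
  have hHfix : ∀ τ : K ≃ₐ[ℚ] K, galoisMap τ H = H := fun τ ↦ by
    rw [hH, map_sum]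
    exact Fintype.sum_equiv (Equiv.mulLeft τ) _ _ fun σ ↦ (galoisMap_mul τ σ _).symm
  have hHeval : evalExp K H = 0 := by
    rw [hH, map_sum]
    exact Finset.sum_eq_zero fun σ _ ↦ by rw [map_mul, hFfix, map_mul, hFeval, zero_mul]
  have hFy : (F * y).coeff 0 = 1 := by
    have := AddMonoidAlgebra.coeff_mul_single_apply F (F.coeff u)⁻¹ (-u) 0
    rw [hy, this]
    simp [hu]
  have hH0 : H.coeff 0 = ((Fintype.card (K ≃ₐ[ℚ] K) : ℤ) : K) := by
    have (σ : K ≃ₐ[ℚ] K) : (galoisMap σ (F * y)).coeff 0 = 1 := by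
      have := coeff_galoisMap σ (F * y) 0
      rwa [map_zero, hFy, map_one] at this
    simp only [hH, AddMonoidAlgebra.coeff_sum, Finsupp.finsetSum_apply, this]
    simp
  refine sum_exp_ne_zero_of_galois_equivariant H.coeff (fun σ u ↦ ?_)
    (Int.natCast_ne_zero.mpr Fintype.card_ne_zero) hH0 ((evalExp_apply H).symm.trans hHeval)
  rw [← coeff_galoisMap, hHfix]

/-- The **Hermite–Lindemann theorem**. -/
theorem transcendental_exp_of_isAlgebraic {a : ℂ} (ha : IsAlgebraic ℚ a) (ha0 : a ≠ 0) :
    Transcendental ℚ (exp a) := by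
  intro hb
  set p := minpoly ℚ a * minpoly ℚ (exp a) with hp
  have hp0 : p ≠ 0 :=
    mul_ne_zero (minpoly.ne_zero ha.isIntegral) (minpoly.ne_zero hb.isIntegral)
  let K := IntermediateField.adjoin ℚ (p.rootSet ℂ)
  have : p.IsSplittingField ℚ K :=
    IntermediateField.adjoin_rootSet_isSplittingField (IsAlgClosed.splits _)
  have : FiniteDimensional ℚ K := IsSplittingField.finiteDimensional K p
  have : NumberField K := {}
  have : Normal ℚ K := Normal.of_isSplittingField p
  have : IsGalois ℚ K := {}
  have mem {x : ℂ} (hx : aeval x p = 0) : x ∈ K :=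
    IntermediateField.subset_adjoin _ _ (mem_rootSet.mpr ⟨hp0, hx⟩)
  let u : K := ⟨a, mem (by simp [hp])⟩
  let v : K := ⟨exp a, mem (by simp [hp])⟩
  have hu : u ≠ 0 := fun h ↦ ha0 (congrArg Subtype.val h)
  refine evalExp_ne_zero (K := K) (x := .single u 1 - .single 0 v) (fun h ↦ ?_) ?_
  · have := congrArg (fun x ↦ x.coeff u) h
    simp [hu.symm] at this
  · rw [map_sub, evalExp_single, evalExp_single]
    simp [u, v]

theorem sumIDeriv_injective {R : Type*} [CommRing R] :
    Function.Injective (sumIDeriv : R[X] →ₗ[R] R[X]) := by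
  refine (injective_iff_map_eq_zero _).mpr fun p hp ↦ ?_
  simpa [hp] using (sumIDeriv_eq_self_add p).symm

theorem eval_zero_sumIDeriv_X_pow {R : Type*} [CommRing R] (n : ℕ) :
    (sumIDeriv (X ^ n : R[X])).eval 0 = n ! := by
  induction n with
  | zero => simpa using congrArg (eval (0 : R)) (sumIDeriv_C (1 : R))
  | succ n ih =>
    rw [sumIDeriv_eq_self_add, ← sumIDeriv_derivative, derivative_X_pow, ← smul_eq_C_mul, map_smul]
    simp [ih, Nat.factorial_succ]

theorem exp_mul_eval_sumIDeriv_X_pow_of_integral_eq_zero {n : ℕ} {w : ℂ}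
    (h : ∫ t in (0 : ℝ)..1, exp (w * t) * (t : ℂ) ^ n = 0) :
    exp w * (sumIDeriv (X ^ n : ℂ[X])).eval (-w) = n ! := by
  have := LindemannWeierstrass.integral_exp_mul_eval (X ^ n) (-w)
  have hint : ∫ x in (0 : ℝ)..1, exp (-(x • -w)) * (X ^ n : ℂ[X]).eval (x • -w) = 0 := by
    rw [← mul_zero ((-w) ^ n), ← h, ← intervalIntegral.integral_const_mul]
    refine intervalIntegral.integral_congr fun x _ ↦ ?_
    simp [mul_comm w]
    ring
  rw [hint, mul_zero, eval_zero_sumIDeriv_X_pow, neg_neg] at this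
  linear_combination this

theorem isAlgebraic_eval_sumIDeriv_X_pow {s : ℂ} (hs : IsAlgebraic ℚ s) (n : ℕ) :
    IsAlgebraic ℚ ((sumIDeriv (X ^ n : ℂ[X])).eval s) := by
  have := aeval_sumIDeriv_eq_eval ℂ (X ^ n : ℚ[X]) s
  rw [Polynomial.map_pow, map_X] at this
  rw [← this]
  exact isAlgebraic_iff_isIntegral.mpr
    (Algebra.adjoin_le (S := integralClosure ℚ ℂ) (Set.singleton_subset_iff.mpr hs.isIntegral)
      (aeval_mem_adjoin_singleton ℚ s))

theorem integral_pow_ne_zero (n : ℕ) : ∫ t in (0 : ℝ)..1, (t : ℂ) ^ n ≠ 0 := by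
  simp only [← ofReal_pow]
  rw [intervalIntegral.integral_ofReal, integral_pow]
  simp
  norm_cast

/-- For `n₁ ≠ n₂`, the entire functions `F_k(z) = ∫₀¹ e^{izt} t^{n_k} dt` have no
common zeroes. -/
theorem stmt15 (n₁ n₂ : ℕ) (hne : n₁ ≠ n₂) :
    ∀ z : ℂ,
      ¬((∫ t in (0:ℝ)..1, Complex.exp (Complex.I * z * t) * (t : ℂ) ^ n₁) = 0 ∧
        (∫ t in (0:ℝ)..1, Complex.exp (Complex.I * z * t) * (t : ℂ) ^ n₂) = 0) := by
  rintro z ⟨h₁, h₂⟩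
  set w := I * z
  have hw : w ≠ 0 := by
    intro hw
    simp only [hw, zero_mul, Complex.exp_zero, one_mul] at h₁
    exact integral_pow_ne_zero n₁ h₁
  have e₁ := exp_mul_eval_sumIDeriv_X_pow_of_integral_eq_zero h₁
  have e₂ := exp_mul_eval_sumIDeriv_X_pow_of_integral_eq_zero h₂
  have hwalg : IsAlgebraic ℚ (-w) := by
    refine ⟨sumIDeriv ((n₂ ! : ℚ) • X ^ n₁ - (n₁ ! : ℚ) • X ^ n₂), ?_, ?_⟩
    · refine (map_ne_zero_iff _ sumIDeriv_injective).mpr fun h ↦ ?_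
      have := congrArg (coeff · n₁) h
      simp [coeff_X_pow, hne, Nat.factorial_ne_zero] at this
    · rw [aeval_sumIDeriv_eq_eval]
      simp only [Polynomial.map_sub, Polynomial.map_smul, Polynomial.map_pow, map_X, map_sub,
        map_smul, eval_sub, eval_smul, map_natCast, smul_eq_mul]
      refine (mul_eq_zero.mp ?_).resolve_left (exp_ne_zero w)
      linear_combination (n₂ ! : ℂ) * e₁ - (n₁ ! : ℂ) * e₂
  refine transcendental_exp_of_isAlgebraic (neg_neg w ▸ hwalg.neg) hw ?_
  have hfac : (n₁ ! : ℂ) ≠ 0 := Nat.cast_ne_zero.mpr n₁.factorial_ne_zero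
  rw [eq_div_of_mul_eq (right_ne_zero_of_mul (e₁ ▸ hfac)) e₁, div_eq_mul_inv]
  exact (isAlgebraic_natCast _).mul (isAlgebraic_eval_sumIDeriv_X_pow hwalg n₁).inv
end

section
/- For distinct nonnegative half-integers ν₁ = n₁ + 1/2 and ν₂ = n₂ + 1/2 with n₁ ≠ n₂ nonnegative integers, the Bessel functions J_{ν₁} and J_{ν₂} have no common zeroes other than z = 0. -/
open MeasureTheory Complex intervalIntegral

/-- Bessel function of the first kind of order `ν > -1/2`, via the Poisson integral
representation. -/
noncomputable def besselJ (ν : ℝ) (z : ℂ) : ℂ :=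
  (z / 2) ^ (ν : ℂ) / (Real.sqrt Real.pi * Complex.Gamma (ν + 1 / 2)) *
    ∫ s in (-1:ℝ)..1, Complex.exp (Complex.I * z * s) * (((1 - s ^ 2) ^ (ν - 1 / 2) : ℝ) : ℂ)

open Polynomial in
theorem exists_int_polynomial_eval_zero_ne_zero (s : Finset ℂ)
    (hs : ∀ a ∈ s, a ≠ 0 ∧ IsAlgebraic ℤ a) :
    ∃ f : ℤ[X], f.eval 0 ≠ 0 ∧ ∀ a ∈ s, aeval a f = 0 := by
  classical
  induction s using Finset.induction_on with
  | empty => exact ⟨1, by simp, by simp⟩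
  | insert a s ha ih =>
    obtain ⟨f, hf0, hf⟩ := ih fun b hb => hs b (Finset.mem_insert_of_mem hb)
    obtain ⟨ha0, haa⟩ := hs a (Finset.mem_insert_self a s)
    obtain ⟨q, hq0, hq⟩ := haa.exists_nonzero_coeff_and_aeval_eq_zero
      (mem_nonZeroDivisors_of_ne_zero ha0)
    refine ⟨q * f, ?_, fun b hb => ?_⟩
    · rw [eval_mul, ← coeff_zero_eq_eval_zero q]
      exact mul_ne_zero hq0 hf0
    · rcases Finset.mem_insert.mp hb with rfl | hb
      · simp [hq]
      · simp [hf b hb]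

open Polynomial in
theorem isIntegral_leadingCoeff_pow_mul_aeval {f g : ℤ[X]} {a : ℂ} {N : ℕ}
    (ha : aeval a f = 0) (hg : g.natDegree ≤ N) :
    IsIntegral ℤ ((f.leadingCoeff : ℂ) ^ N * aeval a g) := by
  have h1 : IsIntegral ℤ ((f.leadingCoeff : ℂ) * a) := by
    simpa using isIntegral_leadingCoeff_smul f a ha
  rw [aeval_eq_sum_range' (Nat.lt_succ_of_le hg), Finset.mul_sum]
  refine IsIntegral.sum _ fun i hi => ?_
  have hi' : i ≤ N := by simpa [Nat.lt_succ_iff] using hi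
  have : (f.leadingCoeff : ℂ) ^ N * g.coeff i • a ^ i
      = ((g.coeff i * f.leadingCoeff ^ (N - i) : ℤ) : ℂ) * ((f.leadingCoeff : ℂ) * a) ^ i := by
    obtain ⟨k, rfl⟩ := Nat.exists_eq_add_of_le hi'
    simp [pow_add, mul_pow]
    ring
  rw [this]
  exact (isIntegral_algebraMap (R := ℤ) (A := ℂ)).mul (h1.pow i)

open Polynomial in
theorem int_add_sum_exp_ne_zero (s : Finset ℂ) (H : ℂ → ℤ) (h₀ : ℤ) (hh₀ : h₀ ≠ 0)
    (hs : ∀ a ∈ s, a ≠ 0 ∧ IsAlgebraic ℤ a)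
    (hrat : ∀ g : ℤ[X], ∃ r : ℚ, ∑ a ∈ s, (H a : ℂ) * aeval a g = r) :
    (h₀ : ℂ) + ∑ a ∈ s, (H a : ℂ) * exp a ≠ 0 := by
  intro hsum
  obtain ⟨f, hf0, hf⟩ := exists_int_polynomial_eval_zero_ne_zero s hs
  have hfne : f ≠ 0 := by rintro rfl; simp at hf0
  obtain ⟨c, hc⟩ := LindemannWeierstrass.exp_polynomial_approx f hf0
  set D := f.leadingCoeff with hD
  have hDne : D ≠ 0 := leadingCoeff_ne_zero.mpr hfne
  set d := f.natDegree
  set C : ℝ := ∑ a ∈ s, ‖(H a : ℂ)‖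
  have key : ∀ p : ℕ, p.Prime → (eval 0 f).natAbs < p → D.natAbs < p → h₀.natAbs < p →
      1 ≤ C * ((‖(D : ℂ)‖ ^ d * |c|) ^ p / (p - 1).factorial) := by
    intro p hp hpf hpD hp0
    obtain ⟨n, hn, g, hgdeg, hg⟩ := hc p hpf hp
    have hg' : g.natDegree ≤ p * d := hgdeg.trans (Nat.sub_le _ _)
    obtain ⟨r, hr⟩ := hrat g
    have hint : IsIntegral ℤ (((D : ℚ) ^ (p * d) * r : ℚ) : ℂ) := by
      push_cast
      rw [← hr, Finset.mul_sum]
      refine IsIntegral.sum _ fun a ha => ?_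
      rw [mul_left_comm]
      exact (isIntegral_algebraMap (R := ℤ) (A := ℂ) (x := H a)).mul
        (isIntegral_leadingCoeff_pow_mul_aeval (hf a ha) hg')
    have hint' : IsIntegral ℤ ((D : ℚ) ^ (p * d) * r) :=
      (isIntegral_algebraMap_iff (algebraMap ℚ ℂ).injective).mp hint
    obtain ⟨t, ht⟩ := IsIntegrallyClosed.isIntegral_iff.mp hint'
    have ht' : (t : ℂ) = (D : ℂ) ^ (p * d) * r := by
      have := congrArg (fun q : ℚ => (q : ℂ)) ht
      simpa using this
    have hpz : Prime (p : ℤ) := Nat.prime_iff_prime_int.mp hp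
    have hnd : ∀ m : ℤ, m ≠ 0 → m.natAbs < p → ¬ (p : ℤ) ∣ m := fun m hm hlt hdvd =>
      absurd (Nat.le_of_dvd (Int.natAbs_pos.mpr hm) (Int.natCast_dvd.mp hdvd)) (by omega)
    have hz : D ^ (p * d) * n * h₀ + p * t ≠ 0 := by
      intro h
      have : (p : ℤ) ∣ D ^ (p * d) * n * h₀ :=
        ⟨-t, by linear_combination h⟩
      rcases hpz.dvd_or_dvd this with h | h
      · rcases hpz.dvd_or_dvd h with h | h
        · exact hnd D hDne hpD (hpz.dvd_of_dvd_pow h)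
        · exact hn h
      · exact hnd h₀ hh₀ hp0 h
    have h1 : (1 : ℝ) ≤ ‖((D ^ (p * d) * n * h₀ + p * t : ℤ) : ℂ)‖ := by
      rw [Complex.norm_intCast]
      exact_mod_cast Int.one_le_abs hz
    have h2 : ((D ^ (p * d) * n * h₀ + p * t : ℤ) : ℂ)
        = - ((D : ℂ) ^ (p * d) * ∑ a ∈ s, (H a : ℂ) * (n • exp a - p • aeval a g)) := by
      have e : ∑ a ∈ s, (H a : ℂ) * (n • exp a - p • aeval a g)
          = n * ∑ a ∈ s, (H a : ℂ) * exp a - p * ∑ a ∈ s, (H a : ℂ) * aeval a g := by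
        rw [Finset.mul_sum, Finset.mul_sum, ← Finset.sum_sub_distrib]
        refine Finset.sum_congr rfl fun a _ => ?_
        simp only [zsmul_eq_mul, nsmul_eq_mul]
        ring
      rw [e, hr]
      push_cast
      rw [ht']
      linear_combination (D : ℂ) ^ (p * d) * n * hsum
    have h3 : ‖∑ a ∈ s, (H a : ℂ) * (n • exp a - p • aeval a g)‖
        ≤ C * (|c| ^ p / (p - 1).factorial) := by
      rw [Finset.sum_mul]
      refine norm_sum_le_of_le _ fun a ha => ?_
      rw [norm_mul]
      gcongr
      refine (hg ((mem_aroots).mpr ⟨hfne, hf a ha⟩)).trans ?_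
      exact div_le_div_of_nonneg_right ((le_abs_self _).trans_eq (abs_pow c p))
        (Nat.cast_nonneg _)
    rw [h2, norm_neg, norm_mul, norm_pow] at h1
    calc (1 : ℝ) ≤ _ := h1
      _ ≤ ‖(D : ℂ)‖ ^ (p * d) * (C * (|c| ^ p / (p - 1).factorial)) := by gcongr
      _ = _ := by rw [mul_pow, ← pow_mul, mul_comm d p]; ring
  set M : ℝ := ‖(D : ℂ)‖ ^ d * |c|
  have hlim : Filter.Tendsto (fun k : ℕ => C * M * (M ^ k / k.factorial)) Filter.atTop
      (nhds 0) := by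
    simpa using (FloorSemiring.tendsto_pow_div_factorial_atTop M).const_mul (C * M)
  obtain ⟨k₀, hk₀⟩ := Filter.eventually_atTop.mp (hlim.eventually_lt_const zero_lt_one)
  obtain ⟨p, hp1, hp⟩ := Nat.exists_infinite_primes
    (k₀ + (eval 0 f).natAbs + D.natAbs + h₀.natAbs + 1)
  have h1 := key p hp (by omega) (by omega) (by omega)
  have h2 := hk₀ (p - 1) (by omega)
  have h3 : M ^ p = M * M ^ (p - 1) := by
    rw [← pow_succ', Nat.sub_add_cancel hp.one_le]
  rw [h3] at h1
  have : C * (M * M ^ (p - 1) / (p - 1).factorial) = C * M * (M ^ (p - 1) / (p - 1).factorial) := by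
    ring
  linarith

/-- The ring homomorphism `ℤ[K] → ℂ` sending the basis element of `a` to `exp a`. -/
noncomputable def expLift (K : IntermediateField ℚ ℂ) : AddMonoidAlgebra ℤ K →ₐ[ℤ] ℂ :=
  AddMonoidAlgebra.lift ℤ ℂ K
    { toFun := fun a => exp ((Multiplicative.toAdd a : K) : ℂ)
      map_one' := by simp
      map_mul' := fun a b => by simp [Complex.exp_add] }

theorem expLift_apply (K : IntermediateField ℚ ℂ) (x : AddMonoidAlgebra ℤ K) :
    expLift K x = ∑ a ∈ x.coeff.support, (x.coeff a : ℂ) * exp (a : ℂ) := by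
  simp [expLift, AddMonoidAlgebra.lift_apply, Finsupp.sum]

/-- The automorphism of `ℤ[K]` induced by a field automorphism of `K`. -/
noncomputable def galCongr {K : IntermediateField ℚ ℂ} (σ : K ≃ₐ[ℚ] K) :
    AddMonoidAlgebra ℤ K ≃ₐ[ℤ] AddMonoidAlgebra ℤ K :=
  AddMonoidAlgebra.domCongr ℤ ℤ (σ : K ≃+ K)

theorem coeff_galCongr {K : IntermediateField ℚ ℂ} (σ : K ≃ₐ[ℚ] K) (x : AddMonoidAlgebra ℤ K)
    (a : K) : (galCongr σ x).coeff a = x.coeff (σ.symm a) := by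
  simp [galCongr]
  rfl

theorem galCongr_mul {K : IntermediateField ℚ ℂ} (σ τ : K ≃ₐ[ℚ] K) (x : AddMonoidAlgebra ℤ K) :
    galCongr (σ * τ) x = galCongr σ (galCongr τ x) := by
  ext a
  simp only [coeff_galCongr]
  rfl

/-- The involution of `ℤ[K]` induced by negation on `K`. -/
noncomputable def negCongr (K : IntermediateField ℚ ℂ) :
    AddMonoidAlgebra ℤ K ≃ₐ[ℤ] AddMonoidAlgebra ℤ K :=
  AddMonoidAlgebra.domCongr ℤ ℤ (AddEquiv.neg K)

theorem coeff_negCongr {K : IntermediateField ℚ ℂ} (x : AddMonoidAlgebra ℤ K)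
    (a : K) : (negCongr K x).coeff a = x.coeff (-a) := by
  simp [negCongr]

theorem galCongr_negCongr {K : IntermediateField ℚ ℂ} (σ : K ≃ₐ[ℚ] K)
    (x : AddMonoidAlgebra ℤ K) : galCongr σ (negCongr K x) = negCongr K (galCongr σ x) := by
  ext a
  simp [coeff_galCongr, coeff_negCongr]

theorem coeff_zero_mul_negCongr_ne_zero {K : IntermediateField ℚ ℂ} {x : AddMonoidAlgebra ℤ K}
    (hx : x ≠ 0) : (x * negCongr K x).coeff 0 ≠ 0 := by
  have h : (x * negCongr K x).coeff 0 = ∑ a ∈ x.coeff.support, x.coeff a ^ 2 := by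
    rw [AddMonoidAlgebra.coeff_mul_apply_left, Finsupp.sum]
    simp [coeff_negCongr, sq]
  rw [h]
  refine (Finset.sum_pos (fun a ha => ?_) ?_).ne'
  · exact sq_pos_of_ne_zero (Finsupp.mem_support_iff.mp ha)
  · rw [Finsupp.support_nonempty_iff]
    simpa using hx

open Polynomial in
theorem expLift_ne_zero_of_coeff_zero_ne_zero {K : IntermediateField ℚ ℂ} [FiniteDimensional ℚ K]
    [IsGalois ℚ K] {x : AddMonoidAlgebra ℤ K} (hx : ∀ σ : K ≃ₐ[ℚ] K, galCongr σ x = x)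
    (hx0 : x.coeff 0 ≠ 0) : expLift K x ≠ 0 := by
  classical
  set S := x.coeff.support.erase 0 with hS
  have hinv : ∀ (σ : K ≃ₐ[ℚ] K) (a : K), x.coeff (σ a) = x.coeff a := fun σ a => by
    conv_lhs => rw [← hx σ, coeff_galCongr, AlgEquiv.symm_apply_apply]
  let H : ℂ → ℤ := fun z => if h : z ∈ K then x.coeff ⟨z, h⟩ else 0
  have hH : ∀ a : K, H a = x.coeff a := fun a => by simp [H]
  have hinj : Set.InjOn (fun a : K => (a : ℂ)) S := Subtype.val_injective.injOn
  have key := int_add_sum_exp_ne_zero (S.image fun a : K => (a : ℂ)) H (x.coeff 0) hx0 ?_ ?_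
  · rw [expLift_apply, ← Finset.add_sum_erase _ _ (Finsupp.mem_support_iff.mpr hx0), ← hS]
    rw [Finset.sum_image hinj] at key
    simpa [hH] using key
  · intro z hz
    obtain ⟨a, ha, rfl⟩ := Finset.mem_image.mp hz
    refine ⟨by simpa using (Finset.mem_erase.mp ha).1, ?_⟩
    have : IsAlgebraic ℚ (a : ℂ) := (Algebra.IsAlgebraic.isAlgebraic (R := ℚ) a).algebraMap
    exact (IsFractionRing.isAlgebraic_iff ℤ ℚ ℂ).mpr this
  · intro g
    set T : K := ∑ a ∈ S, (x.coeff a : K) * aeval a g with hT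
    have hfix : ∀ σ : K ≃ₐ[ℚ] K, σ T = T := fun σ => by
      have hmem : ∀ a, a ∈ S ↔ σ a ∈ S := fun a => by simp [hS, hinv]
      rw [hT, map_sum]
      refine Finset.sum_equiv σ.toEquiv (fun a => hmem a) fun a _ => ?_
      have : σ (aeval a g) = aeval (σ a) g :=
        (aeval_algHom_apply (σ.toAlgHom.restrictScalars ℤ) a g).symm
      simp [hinv, this]
    obtain ⟨r, hr⟩ := (IsGalois.mem_range_algebraMap_iff_fixed (F := ℚ) T).mpr hfix
    refine ⟨r, ?_⟩
    rw [Finset.sum_image hinj]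
    have h1 : ((T : K) : ℂ) = (r : ℂ) := by rw [← hr]; simp
    rw [← h1, hT]
    push_cast
    refine Finset.sum_congr rfl fun a _ => ?_
    have : ((aeval a g : K) : ℂ) = aeval (a : ℂ) g :=
      (aeval_algHom_apply (K.val.restrictScalars ℤ) a g).symm
    rw [hH, this]

theorem expLift_ne_zero {K : IntermediateField ℚ ℂ} [FiniteDimensional ℚ K]
    [IsGalois ℚ K] {x : AddMonoidAlgebra ℤ K} (hx : x ≠ 0) : expLift K x ≠ 0 := by
  classical
  intro hexp
  set N := ∏ σ : K ≃ₐ[ℚ] K, galCongr σ x with hN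
  have hNinv : ∀ τ : K ≃ₐ[ℚ] K, galCongr τ N = N := fun τ => by
    rw [hN, map_prod]
    exact Fintype.prod_equiv (Equiv.mulLeft τ) _ _ fun σ => by simp [galCongr_mul]
  have hN0 : N ≠ 0 := Finset.prod_ne_zero_iff.mpr fun σ _ => by simpa using hx
  have hone : galCongr (1 : K ≃ₐ[ℚ] K) x = x := by
    ext a
    rw [coeff_galCongr]
    rfl
  have hNexp : expLift K N = 0 := by
    rw [hN, map_prod]
    exact Finset.prod_eq_zero (Finset.mem_univ 1) (by rw [hone, hexp])
  refine expLift_ne_zero_of_coeff_zero_ne_zero (x := N * negCongr K N) (fun σ => ?_)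
    (coeff_zero_mul_negCongr_ne_zero hN0) ?_
  · rw [map_mul, galCongr_negCongr, hNinv]
  · rw [map_mul, hNexp, zero_mul]

open Polynomial in
/-- The Hermite–Lindemann theorem. -/
theorem transcendental_exp {α : ℂ} (hα0 : α ≠ 0) (hα : IsAlgebraic ℚ α) :
    Transcendental ℚ (exp α) := by
  intro halg
  obtain ⟨q, hq0, hq⟩ := (IsFractionRing.isAlgebraic_iff ℤ ℚ ℂ).mpr halg
  let K : IntermediateField ℚ ℂ := IntermediateField.adjoin ℚ ((minpoly ℚ α).rootSet ℂ)
  have : (minpoly ℚ α).IsSplittingField ℚ K :=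
    IntermediateField.adjoin_rootSet_isSplittingField (IsAlgClosed.splits _)
  have : FiniteDimensional ℚ K := IsSplittingField.finiteDimensional K (minpoly ℚ α)
  have : Normal ℚ K := Normal.of_isSplittingField (minpoly ℚ α)
  have : IsGalois ℚ K := ⟨⟩
  have hαK : α ∈ K := IntermediateField.subset_adjoin ℚ _
    ((mem_rootSet).mpr ⟨minpoly.ne_zero hα.isIntegral, minpoly.aeval ℚ α⟩)
  let f : ℕ →+ K := multiplesHom K ⟨α, hαK⟩
  have hf : Function.Injective f := fun m n h => by
    have : (m : ℂ) * α = n * α := by simpa [f] using congrArg (fun a : K => (a : ℂ)) h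
    exact_mod_cast mul_right_cancel₀ hα0 this
  refine expLift_ne_zero (K := K) (x := AddMonoidAlgebra.mapDomain f q.toFinsupp) ?_ ?_
  · rw [← AddMonoidAlgebra.mapDomain_zero (f := f)]
    exact (AddMonoidAlgebra.mapDomain_injective hf).ne (by simpa using hq0)
  · have : (expLift K).toRingHom.comp ((AddMonoidAlgebra.mapDomainRingHom ℤ f).comp
        (Polynomial.toFinsuppIso ℤ).toRingHom) = (aeval (exp α) : ℤ[X] →ₐ[ℤ] ℂ).toRingHom := by
      refine Polynomial.ringHom_ext (fun a => by simp) ?_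
      simp [expLift, f]
    have h := congrArg (fun φ : ℤ[X] →+* ℂ => φ q) this
    exact h.trans hq

/-- The Poisson integral `∫ exp (w s) (1 - s²)ⁿ` over `[-1, 1]`. -/
noncomputable def poissonIntegral (n : ℕ) (w : ℂ) : ℂ :=
  ∫ s in (-1 : ℝ)..1, exp (w * s) * (1 - (s : ℂ) ^ 2) ^ n

theorem poissonIntegral_eq_zero_of_besselJ_eq_zero {n : ℕ} {z : ℂ} (hz : z ≠ 0)
    (h : besselJ ((n : ℝ) + 1 / 2) z = 0) : poissonIntegral n (I * z) = 0 := by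
  have hpre : (z / 2) ^ ((((n : ℝ) + 1 / 2 : ℝ)) : ℂ) /
      (Real.sqrt Real.pi * Complex.Gamma ((((n : ℝ) + 1 / 2 : ℝ) : ℂ) + 1 / 2)) ≠ 0 := by
    refine div_ne_zero ?_ (mul_ne_zero ?_ ?_)
    · rw [Ne, Complex.cpow_eq_zero_iff]
      simp [hz]
    · exact_mod_cast (Real.sqrt_pos.mpr Real.pi_pos).ne'
    · have : ((((n : ℝ) + 1 / 2 : ℝ) : ℂ) + 1 / 2) = n + 1 := by
        push_cast
        ring
      rw [this, Complex.Gamma_nat_eq_factorial]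
      exact_mod_cast n.factorial_ne_zero
  have h' := (mul_eq_zero.mp h).resolve_left hpre
  rw [← h', poissonIntegral]
  refine intervalIntegral.integral_congr fun s _ => ?_
  have : (n : ℝ) + 1 / 2 - 1 / 2 = n := by ring
  simp only [this, Real.rpow_natCast]
  push_cast
  rfl

theorem mul_integral_exp_mul (w : ℂ) (P P' : ℝ → ℂ) (hP : ∀ s, HasDerivAt P (P' s) s)
    (hP' : Continuous P') :
    w * ∫ s in (-1 : ℝ)..1, exp (w * s) * P s =
      exp w * P 1 - exp (-w) * P (-1) - ∫ s in (-1 : ℝ)..1, exp (w * s) * P' s := by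
  have hc : Continuous P := continuous_iff_continuousAt.mpr fun s => (hP s).continuousAt
  have hd : ∀ s : ℝ, HasDerivAt (fun s : ℝ => exp (w * s) * P s)
      (w * (exp (w * s) * P s) + exp (w * s) * P' s) s := fun s => by
    have h1 : HasDerivAt (fun s : ℝ => exp (w * s)) (exp (w * s) * (w * 1)) s :=
      ((hasDerivAt_id s).ofReal_comp.const_mul w).cexp
    refine (h1.mul (hP s)).congr_deriv ?_
    ring
  have hint := intervalIntegral.integral_eq_sub_of_hasDerivAt (a := -1) (b := 1)
    (fun s _ => hd s) (Continuous.intervalIntegrable (by fun_prop) _ _)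
  rw [intervalIntegral.integral_add (Continuous.intervalIntegrable (by fun_prop) _ _)
    (Continuous.intervalIntegrable (by fun_prop) _ _),
    intervalIntegral.integral_const_mul] at hint
  simp only [ofReal_one, ofReal_neg, mul_one, mul_neg] at hint
  linear_combination hint

theorem hasDerivAt_one_sub_sq_pow_succ (n : ℕ) (s : ℝ) :
    HasDerivAt (fun s : ℝ => (1 - (s : ℂ) ^ 2) ^ (n + 1))
      (-2 * (n + 1) * s * (1 - (s : ℂ) ^ 2) ^ n) s := by
  have h := ((((hasDerivAt_id s).ofReal_comp).pow 2).const_sub 1).pow (n + 1)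
  refine h.congr_deriv ?_
  simp
  ring

theorem hasDerivAt_mul_one_sub_sq_pow_succ (n : ℕ) (s : ℝ) :
    HasDerivAt (fun s : ℝ => s * (1 - (s : ℂ) ^ 2) ^ (n + 1))
      ((2 * n + 3) * (1 - (s : ℂ) ^ 2) ^ (n + 1) - 2 * (n + 1) * (1 - (s : ℂ) ^ 2) ^ n) s := by
  have h := ((hasDerivAt_id s).ofReal_comp).mul (hasDerivAt_one_sub_sq_pow_succ n s)
  refine h.congr_deriv ?_
  simp
  ring

theorem mul_poissonIntegral_zero (w : ℂ) :
    w * poissonIntegral 0 w = exp w - exp (-w) := by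
  have h := mul_integral_exp_mul w (fun _ => 1) (fun _ => 0) (fun s => hasDerivAt_const s 1)
    continuous_const
  simpa [poissonIntegral] using h

theorem mul_poissonIntegral_succ (n : ℕ) (w : ℂ) :
    w * poissonIntegral (n + 1) w =
      2 * (n + 1) * ∫ s in (-1 : ℝ)..1, exp (w * s) * (s * (1 - (s : ℂ) ^ 2) ^ n) := by
  have h := mul_integral_exp_mul w _ _ (hasDerivAt_one_sub_sq_pow_succ n) (by fun_prop)
  have h' : ∫ s in (-1 : ℝ)..1, exp (w * s) * (-2 * ((n : ℂ) + 1) * s * (1 - (s : ℂ) ^ 2) ^ n) =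
      -(2 * ((n : ℂ) + 1)) * ∫ s in (-1 : ℝ)..1, exp (w * s) * (s * (1 - (s : ℂ) ^ 2) ^ n) := by
    rw [← intervalIntegral.integral_const_mul]
    refine intervalIntegral.integral_congr fun s _ => ?_
    ring
  rw [poissonIntegral, h, h']
  simp

theorem sq_mul_poissonIntegral_one (w : ℂ) :
    w ^ 2 * poissonIntegral 1 w = 2 * (exp w + exp (-w)) - 2 * poissonIntegral 0 w := by
  have h1 := mul_poissonIntegral_succ 0 w
  have h2 := mul_integral_exp_mul w (fun s => (s : ℂ)) (fun _ => 1)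
    (fun s => (hasDerivAt_id s).ofReal_comp) continuous_const
  simp only [poissonIntegral, pow_zero, mul_one, Nat.cast_zero, zero_add, ofReal_one, ofReal_neg]
    at h1 h2 ⊢
  linear_combination w * h1 + 2 * h2

theorem sq_mul_poissonIntegral_add_two (n : ℕ) (w : ℂ) :
    w ^ 2 * poissonIntegral (n + 2) w = 4 * (n + 2) * (n + 1) * poissonIntegral n w -
      2 * (n + 2) * (2 * n + 3) * poissonIntegral (n + 1) w := by
  have h1 := mul_poissonIntegral_succ (n + 1) w
  have h2 := mul_integral_exp_mul w _ _ (hasDerivAt_mul_one_sub_sq_pow_succ n) (by fun_prop)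
  have h3 : ∫ s in (-1 : ℝ)..1, exp (w * s) *
      ((2 * n + 3) * (1 - (s : ℂ) ^ 2) ^ (n + 1) - 2 * (n + 1) * (1 - (s : ℂ) ^ 2) ^ n) =
      (2 * n + 3) * poissonIntegral (n + 1) w - 2 * (n + 1) * poissonIntegral n w := by
    rw [poissonIntegral, poissonIntegral, ← intervalIntegral.integral_const_mul,
      ← intervalIntegral.integral_const_mul, ← intervalIntegral.integral_sub
        (Continuous.intervalIntegrable (by fun_prop) _ _)
        (Continuous.intervalIntegrable (by fun_prop) _ _)]
    refine intervalIntegral.integral_congr fun s _ => ?_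
    ring
  rw [h3] at h2
  simp at h1 h2
  linear_combination w * h1 + 2 * (n + 2) * h2

theorem poissonIntegral_succ_ne_zero {n : ℕ} {w : ℂ}
    (h : poissonIntegral n w = 0) : poissonIntegral (n + 1) w ≠ 0 := by
  induction n with
  | zero =>
    intro h1
    have e0 := mul_poissonIntegral_zero w
    have e1 := sq_mul_poissonIntegral_one w
    rw [h] at e0 e1
    rw [h1] at e1
    have : exp w = 0 := by linear_combination -e0 / 2 - e1 / 4
    exact exp_ne_zero w this
  | succ n ih =>
    intro h2
    have e := sq_mul_poissonIntegral_add_two n w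
    rw [h, h2] at e
    have hc : (4 * (n + 2) * (n + 1) : ℂ) ≠ 0 := by
      exact_mod_cast (by positivity : 4 * (n + 2) * (n + 1) ≠ 0)
    have h0 : poissonIntegral n w = 0 := by
      refine (mul_eq_zero.mp ?_).resolve_left hc
      linear_combination -e
    exact ih h0 h

open Polynomial in
/-- The Lommel relation: if `poissonIntegral n w = 0`, then the later integrals are, up to a power
of `w`, integer polynomials in `w` with nonzero constant term times `poissonIntegral (n + 1) w`. -/
theorem exists_lommel_polynomial {n : ℕ} {w : ℂ} (h : poissonIntegral n w = 0) (k : ℕ) :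
    ∃ P : ℤ[X], P.eval 0 ≠ 0 ∧
      w ^ (2 * k) * poissonIntegral (n + 1 + k) w = aeval w P * poissonIntegral (n + 1) w := by
  suffices H : ∃ P Q : ℤ[X], P.eval 0 ≠ 0 ∧ Q.eval 0 ≠ 0 ∧
      w ^ (2 * k) * poissonIntegral (n + 1 + k) w = aeval w P * poissonIntegral (n + 1) w ∧
      w ^ (2 * (k + 1)) * poissonIntegral (n + 1 + (k + 1)) w =
        aeval w Q * poissonIntegral (n + 1) w by
    obtain ⟨P, -, hP, -, hPw, -⟩ := H
    exact ⟨P, hP, hPw⟩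
  have hC : ∀ z : ℤ, aeval w (C z) = (z : ℂ) := fun z => by simp
  induction k with
  | zero =>
    refine ⟨1, C (-(2 * (n + 2) * (2 * n + 3))), by simp, ?_, by simp, ?_⟩
    · rw [eval_C, neg_ne_zero]
      positivity
    · have e := sq_mul_poissonIntegral_add_two n w
      rw [h] at e
      rw [hC, zero_add, mul_one]
      push_cast
      linear_combination e
  | succ k ih =>
    obtain ⟨P, Q, hP, hQ, hPw, hQw⟩ := ih
    have e := sq_mul_poissonIntegral_add_two (n + 1 + k) w
    set N : ℤ := n + 1 + k with hN
    refine ⟨Q, C (4 * (N + 2) * (N + 1)) * X ^ 2 * P - C (2 * (N + 2) * (2 * N + 3)) * Q,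
      hQ, ?_, hQw, ?_⟩
    · have : 2 * (N + 2) * (2 * N + 3) ≠ 0 := by positivity
      simpa using ⟨by simpa using this, hQ⟩
    · have hNc : (N : ℂ) = n + 1 + k := by simp [hN]
      rw [map_sub, map_mul (aeval w), map_mul (aeval w), map_mul (aeval w), map_pow, aeval_X, hC,
        hC]
      push_cast at e ⊢
      rw [hNc]
      have hi : n + 1 + (k + 1 + 1) = n + 1 + k + 2 := by ring
      have hj : n + 1 + (k + 1) = n + 1 + k + 1 := by ring
      rw [hj] at hQw
      rw [hi]
      linear_combination w ^ (2 * (k + 1)) * e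
        + 4 * (n + 1 + k + 2) * (n + 1 + k + 1) * w ^ 2 * hPw
        - 2 * (n + 1 + k + 2) * (2 * (n + 1 + k) + 3) * hQw

theorem isAlgebraic_of_poissonIntegral_eq_zero {m n : ℕ} {w : ℂ} (hmn : m < n)
    (hm : poissonIntegral m w = 0) (hn : poissonIntegral n w = 0) : IsAlgebraic ℚ w := by
  obtain ⟨k, rfl⟩ := Nat.exists_eq_add_of_lt hmn
  obtain ⟨P, hP, hPw⟩ := exists_lommel_polynomial hm k
  rw [show m + 1 + k = m + k + 1 by ring, hn, mul_zero, eq_comm] at hPw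
  refine (IsFractionRing.isAlgebraic_iff ℤ ℚ ℂ).mp ⟨P, ?_, ?_⟩
  · rintro rfl
    simp at hP
  · exact (mul_eq_zero.mp hPw).resolve_right (poissonIntegral_succ_ne_zero hm)

theorem exists_isAlgebraic_poissonIntegral_eq {w : ℂ} (hw : w ≠ 0) (hwa : IsAlgebraic ℚ w)
    (n : ℕ) : ∃ A B A' B' : algebraicClosure ℚ ℂ,
      poissonIntegral n w = A * exp w + B * exp (-w) ∧
      poissonIntegral (n + 1) w = A' * exp w + B' * exp (-w) ∧ A * B' - A' * B ≠ 0 := by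
  let v : algebraicClosure ℚ ℂ := ⟨w, mem_algebraicClosure_iff.mpr hwa⟩
  have hv : v ≠ 0 := fun h => hw (congrArg (fun a : algebraicClosure ℚ ℂ => (a : ℂ)) h)
  have hvw : (v : ℂ) = w := rfl
  have hcast₂ : ((2 : algebraicClosure ℚ ℂ) : ℂ) = 2 := rfl
  have hcast₃ : ((3 : algebraicClosure ℚ ℂ) : ℂ) = 3 := rfl
  have hcast₄ : ((4 : algebraicClosure ℚ ℂ) : ℂ) = 4 := rfl
  induction n with
  | zero =>
    have e0 := mul_poissonIntegral_zero w
    have e1 := sq_mul_poissonIntegral_one w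
    have h0 : poissonIntegral 0 w = (exp w - exp (-w)) / w := by
      rw [← e0]
      field_simp
    refine ⟨1 / v, -1 / v, (2 - 2 / v) / v ^ 2, (2 + 2 / v) / v ^ 2, ?_, ?_, ?_⟩
    · rw [h0]
      push_cast
      rw [hvw]
      ring
    · rw [h0] at e1
      push_cast
      rw [hvw, hcast₂]
      have : poissonIntegral 1 w = w ^ 2 * poissonIntegral 1 w / w ^ 2 := by field_simp
      rw [this, e1]
      ring
    · have : 1 / v * ((2 + 2 / v) / v ^ 2) - (2 - 2 / v) / v ^ 2 * (-1 / v) = 4 / v ^ 3 := by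
        field_simp
        ring
      rw [this]
      exact div_ne_zero (by norm_num) (pow_ne_zero 3 hv)
  | succ n ih =>
    obtain ⟨A, B, A', B', h0, h1, hdet⟩ := ih
    have e := sq_mul_poissonIntegral_add_two n w
    refine ⟨A', B', (4 * (n + 2) * (n + 1) * A - 2 * (n + 2) * (2 * n + 3) * A') / v ^ 2,
      (4 * (n + 2) * (n + 1) * B - 2 * (n + 2) * (2 * n + 3) * B') / v ^ 2, h1, ?_, ?_⟩
    · have : poissonIntegral (n + 2) w = w ^ 2 * poissonIntegral (n + 2) w / w ^ 2 := by
        field_simp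
      rw [show n + 1 + 1 = n + 2 from rfl, this, e, h0, h1]
      push_cast
      rw [hvw, hcast₂, hcast₃, hcast₄]
      ring
    · have hc : (4 * (n + 2) * (n + 1) : algebraicClosure ℚ ℂ) ≠ 0 := by
        exact_mod_cast (by positivity : 4 * (n + 2) * (n + 1) ≠ 0)
      have := div_ne_zero (mul_ne_zero hc hdet) (pow_ne_zero 2 hv)
      rw [← neg_ne_zero] at this
      convert this using 1
      ring

theorem poissonIntegral_ne_zero_of_isAlgebraic {w : ℂ} (hw : w ≠ 0) (hwa : IsAlgebraic ℚ w)
    (n : ℕ) : poissonIntegral n w ≠ 0 := by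
  intro h
  obtain ⟨A, B, A', B', h0, -, hdet⟩ := exists_isAlgebraic_poissonIntegral_eq hw hwa n
  rw [h] at h0
  have hexp : exp w * exp (-w) = 1 := by rw [← Complex.exp_add, add_neg_cancel, Complex.exp_zero]
  by_cases hA : A = 0
  · refine hdet ?_
    rw [hA, ZeroMemClass.coe_zero, zero_mul, zero_add, eq_comm] at h0
    have hB : B = 0 := by
      exact_mod_cast (mul_eq_zero.mp h0).resolve_right (exp_ne_zero _)
    rw [hA, hB, zero_mul, mul_zero, sub_zero]
  · have hA' : (A : ℂ) ≠ 0 := by exact_mod_cast hA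
    have h2 : exp (2 * w) = ((-B / A : algebraicClosure ℚ ℂ) : ℂ) := by
      push_cast
      rw [eq_div_iff hA', two_mul, Complex.exp_add]
      linear_combination -exp w * h0 - B * hexp
    refine transcendental_exp (mul_ne_zero two_ne_zero hw)
      ((isAlgebraic_algebraMap (2 : ℚ)).mul hwa) ?_
    rw [h2]
    exact mem_algebraicClosure_iff.mp (SetLike.coe_mem _)

/-- Bourget-type: for `n₁ ≠ n₂`, the Bessel functions `J_{n₁+1/2}` and
`J_{n₂+1/2}` have no common zeroes other than `z = 0`. -/
theorem stmt16 (n₁ n₂ : ℕ) (hne : n₁ ≠ n₂) :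
    ∀ z : ℂ, z ≠ 0 →
      ¬(besselJ ((n₁ : ℝ) + 1 / 2) z = 0 ∧ besselJ ((n₂ : ℝ) + 1 / 2) z = 0) := by
  intro z hz ⟨h₁, h₂⟩
  have hw : I * z ≠ 0 := mul_ne_zero I_ne_zero hz
  have p₁ := poissonIntegral_eq_zero_of_besselJ_eq_zero hz h₁
  have p₂ := poissonIntegral_eq_zero_of_besselJ_eq_zero hz h₂
  have halg : IsAlgebraic ℚ (I * z) := by
    rcases hne.lt_or_gt with h | h
    · exact isAlgebraic_of_poissonIntegral_eq_zero h p₁ p₂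
    · exact isAlgebraic_of_poissonIntegral_eq_zero h p₂ p₁
  exact poissonIntegral_ne_zero_of_isAlgebraic hw halg n₁ p₁
end
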